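/- Let n ≥ 3, M ≥ 1, a ∈ ℝ, and x = (x', x_n) ∈ ℝ^{n−1}×ℝ. Then the Newtonian (λ = 0) half-space potential of η_{2M} satisfies ∫_{y_n ≥ a} (Γ(n/2 − 1)/(4π^{n/2})) |x−y|^{2−n} η_{2M}(y) dy = (1/(8π^{n/2})) ∫₀^∞ e^{−|x|²/(1+t)} [ erfc(F(t,x_n,a)) 𝒫_M(x,t) + π^{−1/2} e^{−F(t,x_n,a)²} 𝒬_M(x,t,a) ] dt. -/

import Mathlib

open MeasureTheory Real Finset

/-- Generalized Laguerre polynomial `L_k^{(γ)}(y)`. -/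
noncomputable def lag (k : ℕ) (γ : ℝ) (y : ℝ) : ℝ :=
  ∑ i ∈ Finset.range (k + 1),
    (-1 : ℝ) ^ i * (Real.Gamma ((k : ℝ) + γ + 1) /
      (Real.Gamma ((i : ℝ) + γ + 1) * ((k - i).factorial : ℝ))) * y ^ i / (i.factorial : ℝ)

/-- Physicists' Hermite polynomial `H_k(x)`. -/
noncomputable def herm (k : ℕ) (x : ℝ) : ℝ :=
  (-1 : ℝ) ^ k * Real.exp (x ^ 2) * iteratedDeriv k (fun y => Real.exp (-y ^ 2)) x

/-- Complementary error function. -/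
noncomputable def erfc (z : ℝ) : ℝ :=
  (2 / Real.sqrt Real.pi) * ∫ s in Set.Ioi z, Real.exp (-s ^ 2)

/-- The function `F(t,x,a) = √((1+t)/t)·(a − x/(1+t))`. -/
noncomputable def Fn (t x a : ℝ) : ℝ :=
  Real.sqrt ((1 + t) / t) * (a - x / (1 + t))

/-- The generating function `η_{2M}` on `ℝⁿ`. -/
noncomputable def eta (n M : ℕ) (x : EuclideanSpace ℝ (Fin n)) : ℝ :=
  Real.pi ^ (-(n : ℝ) / 2) * lag (M - 1) ((n : ℝ) / 2) (‖x‖ ^ 2) * Real.exp (-‖x‖ ^ 2)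

/-- `𝒫_M(x,t)` in dimension `n`, as a function of `s2 = |x|²`. -/
noncomputable def calP (n M : ℕ) (s2 t : ℝ) : ℝ :=
  ∑ k ∈ Finset.range M,
    (1 + t) ^ (-(k : ℝ) - (n : ℝ) / 2) * lag k ((n : ℝ) / 2 - 1) (s2 / (1 + t))

/-- `𝒬_M(x,t,a)` in dimension `n`, as a function of `r2 = |x'|²` and `xn`. -/
noncomputable def calQ (n M : ℕ) (r2 xn t a : ℝ) : ℝ :=
  2 * (1 + t) ^ (-((n : ℝ) - 1) / 2) *
    ∑ k ∈ Finset.range M, ∑ l ∈ Finset.range (k + 1),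
      ((-1 : ℝ) ^ (k - l) / (((k - l).factorial : ℝ) * (4 : ℝ) ^ (k - l))) *
        lag l (((n : ℝ) - 3) / 2) (r2 / (1 + t)) *
        ∑ j ∈ Finset.Icc 1 (2 * (k - l)),
          ((-1 : ℝ) ^ j / t ^ ((j : ℝ) / 2)) *
            (((2 * (k - l)).choose j : ℝ) * herm (2 * (k - l) - j) (xn / Real.sqrt (1 + t)) *
                herm (j - 1) (Fn t xn a) / (1 + t) ^ ((k : ℝ) + 1 / 2)
              - herm (j - 1) ((a - xn) / Real.sqrt t) * herm (2 * (k - l) - j) a /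
                  (1 + t) ^ (l : ℝ))

/-- `G` is the formal power series `(1 - X)^(-γ-1) exp (-y X / (1 - X))`, the generating series of
the Laguerre polynomials, expressed through its differential equation. -/
def IsLaguerreSeries (γ y : ℝ) (G : PowerSeries ℝ) : Prop :=
  PowerSeries.constantCoeff G = 1 ∧
    (1 - PowerSeries.X) ^ 2 * PowerSeries.derivative ℝ G =
      (PowerSeries.C (γ + 1) * (1 - PowerSeries.X) - PowerSeries.C y) * G

open PowerSeries in
lemma IsLaguerreSeries.mul {α β x y : ℝ} {G H : PowerSeries ℝ}
    (hG : IsLaguerreSeries α x G) (hH : IsLaguerreSeries β y H) :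
    IsLaguerreSeries (α + β + 1) (x + y) (G * H) := by
  refine ⟨by simp [hG.1, hH.1], ?_⟩
  rw [Derivation.leibniz]
  have e1 := hG.2
  have e2 := hH.2
  simp only [map_add, map_one, smul_eq_mul] at *
  linear_combination H * e1 + G * e2

open PowerSeries in
lemma isLaguerreSeries_one : IsLaguerreSeries (-1) 0 1 := by
  refine ⟨by simp, by simp⟩

open PowerSeries in
lemma isLaguerreSeries_geom : IsLaguerreSeries 0 0 (PowerSeries.mk fun _ => 1) := by
  have h : (PowerSeries.mk fun _ => (1 : ℝ)) * (1 - X) = 1 := mk_one_mul_one_sub_eq_one ℝ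
  have h2 := congrArg (PowerSeries.derivative ℝ) h
  rw [Derivation.leibniz] at h2
  refine ⟨by rw [← coeff_zero_eq_constantCoeff_apply, coeff_mk], ?_⟩
  simp only [smul_eq_mul, map_sub, Derivation.map_one_eq_zero, derivative_X] at h2
  simp only [zero_add, map_one, map_zero]
  linear_combination (1 - X) * h2

lemma isLaguerreSeries_prod {ι : Type*} (s : Finset ι) (γ y : ι → ℝ) (G : ι → PowerSeries ℝ)
    (h : ∀ i ∈ s, IsLaguerreSeries (γ i) (y i) (G i)) :
    IsLaguerreSeries (∑ i ∈ s, (γ i + 1) - 1) (∑ i ∈ s, y i) (∏ i ∈ s, G i) := by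
  classical
  induction s using Finset.induction_on with
  | empty => simpa using isLaguerreSeries_one
  | insert i s hi ih =>
    rw [Finset.sum_insert hi, Finset.sum_insert hi, Finset.prod_insert hi]
    convert (h i (by simp)).mul (ih fun j hj => h j (by simp [hj])) using 1
    ring

open PowerSeries in
lemma isLaguerreSeries_iff {γ y : ℝ} {u : ℕ → ℝ} :
    IsLaguerreSeries γ y (PowerSeries.mk u) ↔
      u 0 = 1 ∧ u 1 = (1 + γ - y) * u 0 ∧
        ∀ k : ℕ, ((k : ℝ) + 2) * u (k + 2) =
          (2 * k + 3 + γ - y) * u (k + 1) - (k + 1 + γ) * u k := by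
  have key : ∀ G : PowerSeries ℝ, (1 - X) ^ 2 * PowerSeries.derivative ℝ G =
      PowerSeries.derivative ℝ G - X * (C 2 * PowerSeries.derivative ℝ G)
        + X * (X * PowerSeries.derivative ℝ G) := by
    intro G
    have : (C 2 : PowerSeries ℝ) = 2 := map_ofNat C 2
    rw [this]; ring
  obtain ⟨A, hA⟩ : ∃ A, A = γ + 1 - y := ⟨_, rfl⟩
  obtain ⟨B, hB⟩ : ∃ B, B = γ + 1 := ⟨_, rfl⟩
  have key2 : ∀ G : PowerSeries ℝ, (C (γ + 1) * (1 - X) - C y) * G =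
      C A * G - X * (C B * G) := by
    intro G
    simp only [hA, hB, map_sub, map_add]
    ring
  unfold IsLaguerreSeries
  rw [key, key2, PowerSeries.ext_iff, ← coeff_zero_eq_constantCoeff_apply, coeff_mk]
  refine and_congr_right fun h0 => ⟨fun h => ⟨?_, fun k => ?_⟩, fun ⟨h1, h⟩ n => ?_⟩
  · have := h 0
    simp only [map_add, map_sub, coeff_zero_X_mul, coeff_C_mul, coeff_derivative, coeff_mk] at this
    push_cast at this
    subst hA
    linear_combination this
  · have := h (k + 1)
    rcases k with _ | k <;>
    · simp only [map_add, map_sub, coeff_zero_X_mul, coeff_succ_X_mul, coeff_C_mul,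
        coeff_derivative, coeff_mk] at this
      push_cast at this ⊢
      subst hA hB
      linear_combination this
  · rcases n with _ | _ | k
    · simp only [map_add, map_sub, coeff_zero_X_mul, coeff_C_mul, coeff_derivative, coeff_mk]
      push_cast
      subst hA
      linear_combination h1
    · have := h 0
      simp only [map_add, map_sub, coeff_zero_X_mul, coeff_succ_X_mul, coeff_C_mul,
        coeff_derivative, coeff_mk]
      push_cast at this ⊢
      subst hA hB
      linear_combination this
    · have := h (k + 1)
      simp only [map_add, map_sub, coeff_succ_X_mul, coeff_C_mul,
        coeff_derivative, coeff_mk]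
      push_cast at this ⊢
      subst hA hB
      linear_combination this

open PowerSeries in
lemma IsLaguerreSeries.unique {γ y : ℝ} {G H : PowerSeries ℝ}
    (hG : IsLaguerreSeries γ y G) (hH : IsLaguerreSeries γ y H) : G = H := by
  have eG : G = PowerSeries.mk fun n => coeff n G := by ext; simp
  have eH : H = PowerSeries.mk fun n => coeff n H := by ext; simp
  rw [eG] at hG
  rw [eH] at hH
  obtain ⟨g0, g1, g⟩ := isLaguerreSeries_iff.1 hG
  obtain ⟨h0, h1, h⟩ := isLaguerreSeries_iff.1 hH
  ext n
  induction n using Nat.twoStepInduction with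
  | zero => rw [g0, h0]
  | one => rw [g1, h1, g0, h0]
  | more n ih1 ih2 =>
    have e1 := g n
    have e2 := h n
    have : (n : ℝ) + 2 ≠ 0 := by positivity
    apply mul_left_cancel₀ this
    rw [e1, e2, ih1, ih2]

/-- The coefficient of `(-y) ^ i` in `lag k γ y`. -/
noncomputable def lagCoeff (k i : ℕ) (γ : ℝ) : ℝ :=
  if i ≤ k then Real.Gamma ((k : ℝ) + γ + 1) /
    (Real.Gamma ((i : ℝ) + γ + 1) * ((k - i).factorial : ℝ) * (i.factorial : ℝ)) else 0

lemma lag_eq_sum_lagCoeff {k N : ℕ} (h : k + 1 ≤ N) (γ y : ℝ) :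
    lag k γ y = ∑ i ∈ Finset.range N, lagCoeff k i γ * (-y) ^ i := by
  unfold lag
  rw [← Finset.sum_subset (Finset.range_subset_range.2 h)]
  · refine Finset.sum_congr rfl fun i hi => ?_
    have : i ≤ k := by simpa [Nat.lt_succ_iff] using hi
    rw [lagCoeff, if_pos this, neg_pow y i]
    field_simp
  · intro i _ hi
    have : ¬ i ≤ k := by simpa [Nat.lt_succ_iff] using hi
    rw [lagCoeff, if_neg this, zero_mul]

lemma lagCoeff_zero_rec {γ : ℝ} (hγ : -1 < γ) (k : ℕ) :
    ((k : ℝ) + 2) * lagCoeff (k + 2) 0 γ =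
      (2 * k + 3 + γ) * lagCoeff (k + 1) 0 γ - (k + 1 + γ) * lagCoeff k 0 γ := by
  have hk : (0 : ℝ) < k + γ + 1 := by have := k.cast_nonneg (α := ℝ); linarith
  have G1 : Real.Gamma ((k + 1 : ℕ) + γ + 1) = (k + γ + 1) * Real.Gamma (k + γ + 1) := by
    rw [← Real.Gamma_add_one hk.ne']; push_cast; ring_nf
  have G2 : Real.Gamma ((k + 2 : ℕ) + γ + 1) =
      (k + γ + 2) * ((k + γ + 1) * Real.Gamma (k + γ + 1)) := by
    rw [← Real.Gamma_add_one hk.ne', ← show (k : ℝ) + γ + 1 + 1 = k + γ + 2 by ring,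
      ← Real.Gamma_add_one (by positivity)]; push_cast; ring_nf
  have hG : Real.Gamma ((0 : ℕ) + γ + 1) ≠ 0 := (Real.Gamma_pos_of_pos (by simp; linarith)).ne'
  have hG' : Real.Gamma (k + γ + 1) ≠ 0 := (Real.Gamma_pos_of_pos hk).ne'
  simp only [lagCoeff, Nat.zero_le, if_true, G1, G2, Nat.sub_zero, Nat.factorial_succ,
    Nat.factorial_zero]
  push_cast
  field_simp
  ring

lemma lagCoeff_succ_rec {γ : ℝ} (hγ : -1 < γ) (k i : ℕ) :
    ((k : ℝ) + 2) * lagCoeff (k + 2) (i + 1) γ =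
      (2 * k + 3 + γ) * lagCoeff (k + 1) (i + 1) γ + lagCoeff (k + 1) i γ
        - (k + 1 + γ) * lagCoeff k (i + 1) γ := by
  have hk : (0 : ℝ) < k + γ + 1 := by have := k.cast_nonneg (α := ℝ); linarith
  have hi : (0 : ℝ) < i + γ + 1 := by have := i.cast_nonneg (α := ℝ); linarith
  have G1 : Real.Gamma ((k + 1 : ℕ) + γ + 1) = (k + γ + 1) * Real.Gamma (k + γ + 1) := by
    rw [← Real.Gamma_add_one hk.ne']; push_cast; ring_nf
  have G2 : Real.Gamma ((k + 2 : ℕ) + γ + 1) =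
      (k + γ + 2) * ((k + γ + 1) * Real.Gamma (k + γ + 1)) := by
    rw [← Real.Gamma_add_one hk.ne', ← show (k : ℝ) + γ + 1 + 1 = k + γ + 2 by ring,
      ← Real.Gamma_add_one (by positivity)]; push_cast; ring_nf
  have G3 : Real.Gamma ((i + 1 : ℕ) + γ + 1) = (i + γ + 1) * Real.Gamma (i + γ + 1) := by
    rw [← Real.Gamma_add_one hi.ne']; push_cast; ring_nf
  have hG : Real.Gamma (i + γ + 1) ≠ 0 := (Real.Gamma_pos_of_pos hi).ne'
  have hG' : Real.Gamma (k + γ + 1) ≠ 0 := (Real.Gamma_pos_of_pos hk).ne'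
  simp only [lagCoeff, G1, G2, G3]
  rcases lt_trichotomy i k with h | h | h
  · obtain ⟨m, rfl⟩ := Nat.exists_eq_add_of_lt h
    rw [if_pos (by lia), if_pos (by lia), if_pos (by lia), if_pos (by lia),
      show i + m + 1 + 2 - (i + 1) = m + 2 by lia, show i + m + 1 + 1 - (i + 1) = m + 1 by lia,
      show i + m + 1 + 1 - i = m + 2 by lia, show i + m + 1 - (i + 1) = m by lia]
    simp only [Nat.factorial_succ]
    push_cast at *
    field_simp
    ring
  · subst h
    rw [if_pos (by lia), if_pos (by lia), if_pos (by lia), if_neg (by lia),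
      show i + 2 - (i + 1) = 1 by lia, show i + 1 - (i + 1) = 0 by lia,
      show i + 1 - i = 1 by lia]
    simp only [Nat.factorial_succ, Nat.factorial_zero]
    push_cast at *
    field_simp
    ring
  · rcases Nat.lt_or_ge (k + 1) i with h' | h'
    · rw [if_neg (by lia), if_neg (by lia), if_neg (by lia), if_neg (by lia)]
      ring
    · obtain rfl : i = k + 1 := by lia
      rw [if_pos (by lia), if_neg (by lia), if_pos (by lia), if_neg (by lia),
        show k + 2 - (k + 1 + 1) = 0 by lia, show k + 1 - (k + 1) = 0 by lia]
      simp only [Nat.factorial_succ, Nat.factorial_zero]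
      push_cast at *
      have e : Real.Gamma ((k : ℝ) + 1 + γ + 1) = (k + γ + 1) * Real.Gamma (k + γ + 1) := by
        rw [← Real.Gamma_add_one hk.ne']; ring_nf
      rw [e]
      field_simp
      ring

lemma isLaguerreSeries_lag {γ : ℝ} (hγ : -1 < γ) (y : ℝ) :
    IsLaguerreSeries γ y (PowerSeries.mk fun k => lag k γ y) := by
  have h1 : Real.Gamma (γ + 1) ≠ 0 := (Real.Gamma_pos_of_pos (by linarith)).ne'
  have h2 : Real.Gamma (1 + γ + 1) = (γ + 1) * Real.Gamma (γ + 1) := by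
    rw [← Real.Gamma_add_one (by linarith)]; ring_nf
  have h0 : lag 0 γ y = 1 := by simp [lag, h1]
  rw [isLaguerreSeries_iff]
  refine ⟨h0, ?_, fun k => ?_⟩
  · have h3 : γ + 1 ≠ 0 := by linarith
    rw [h0]
    simp [lag, Finset.sum_range_succ, h2]
    field_simp
    ring
  · rw [lag_eq_sum_lagCoeff (k := k + 2) (N := k + 3) (by lia),
      lag_eq_sum_lagCoeff (k := k) (N := k + 3) (by lia), sub_mul,
      lag_eq_sum_lagCoeff (k := k + 1) (N := k + 3) (by lia)]
    have e : y * ∑ i ∈ Finset.range (k + 3), lagCoeff (k + 1) i γ * (-y) ^ i =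
        - ∑ i ∈ Finset.range (k + 2), lagCoeff (k + 1) i γ * (-y) ^ (i + 1) := by
      rw [← lag_eq_sum_lagCoeff (k := k + 1) (N := k + 3) (by lia),
        lag_eq_sum_lagCoeff (k := k + 1) (N := k + 2) (by lia), Finset.mul_sum,
        ← Finset.sum_neg_distrib]
      exact Finset.sum_congr rfl fun i _ => by ring
    rw [e]
    simp only [Finset.sum_range_succ' _ (k + 2), mul_add, Finset.mul_sum]
    have c0 := lagCoeff_zero_rec hγ k
    have c1 : ∑ i ∈ Finset.range (k + 2),
        ((k : ℝ) + 2) * (lagCoeff (k + 2) (i + 1) γ * (-y) ^ (i + 1)) =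
        ∑ i ∈ Finset.range (k + 2), (2 * k + 3 + γ) * (lagCoeff (k + 1) (i + 1) γ * (-y) ^ (i + 1))
        + ∑ i ∈ Finset.range (k + 2), lagCoeff (k + 1) i γ * (-y) ^ (i + 1)
        - ∑ i ∈ Finset.range (k + 2), (k + 1 + γ) * (lagCoeff k (i + 1) γ * (-y) ^ (i + 1)) := by
      rw [← Finset.sum_add_distrib, ← Finset.sum_sub_distrib]
      refine Finset.sum_congr rfl fun i _ => ?_
      linear_combination (-y) ^ (i + 1) * lagCoeff_succ_rec hγ k i
    rw [c1]
    simp only [pow_zero, mul_one]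
    linear_combination c0

/-- Addition formula for Laguerre polynomials. -/
lemma lag_add {α β : ℝ} (hα : -1 < α) (hβ : -1 < β) (x y : ℝ) (k : ℕ) :
    lag k (α + β + 1) (x + y) =
      ∑ l ∈ Finset.range (k + 1), lag l α x * lag (k - l) β y := by
  have h := (isLaguerreSeries_lag (by linarith : -1 < α + β + 1) (x + y)).unique
    ((isLaguerreSeries_lag hα x).mul (isLaguerreSeries_lag hβ y))
  have := congrArg (PowerSeries.coeff k) h
  rw [PowerSeries.coeff_mul, Finset.Nat.sum_antidiagonal_eq_sum_range_succ_mk] at this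
  simpa using this

lemma lag_add_one {γ : ℝ} (hγ : -1 < γ) (y : ℝ) (k : ℕ) :
    lag k (γ + 1) y = ∑ l ∈ Finset.range (k + 1), lag l γ y := by
  have h := (isLaguerreSeries_lag (by linarith : -1 < γ + 1) y).unique
    (by simpa using (isLaguerreSeries_lag hγ y).mul isLaguerreSeries_geom)
  have := congrArg (PowerSeries.coeff k) h
  rw [PowerSeries.coeff_mul, Finset.Nat.sum_antidiagonal_eq_sum_range_succ_mk] at this
  simpa using this

lemma lag_sum {n : ℕ} (hn : 1 ≤ n) (y : Fin n → ℝ) (k : ℕ) :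
    lag k ((n : ℝ) / 2 - 1) (∑ i, y i) =
      ∑ α ∈ Finset.univ.finsuppAntidiag k, ∏ i, lag (α i) (-1 / 2) (y i) := by
  have hn' : (1 : ℝ) ≤ n := by exact_mod_cast hn
  have h1 := isLaguerreSeries_prod Finset.univ (fun _ : Fin n => (-1 / 2 : ℝ)) y _
    fun i _ => isLaguerreSeries_lag (by norm_num) (y i)
  have e : ∑ _i : Fin n, ((-1 / 2 : ℝ) + 1) - 1 = n / 2 - 1 := by simp; ring
  rw [e] at h1
  have := congrArg (PowerSeries.coeff k)
    ((isLaguerreSeries_lag (by linarith : (-1 : ℝ) < n / 2 - 1) (∑ i, y i)).unique h1)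
  rw [PowerSeries.coeff_prod] at this
  simpa using this
/-- Iterated derivatives of the Gaussian `exp (-y ^ 2)`. -/
noncomputable def gaussDeriv (j : ℕ) (x : ℝ) : ℝ :=
  iteratedDeriv j (fun y => Real.exp (-y ^ 2)) x

lemma gaussDeriv_zero (x : ℝ) : gaussDeriv 0 x = Real.exp (-x ^ 2) := by simp [gaussDeriv]

lemma hasDerivAt_gaussDeriv (j : ℕ) (x : ℝ) :
    HasDerivAt (gaussDeriv j) (gaussDeriv (j + 1) x) x := by
  have h : ContDiff ℝ (j + 1 : ℕ) (fun y : ℝ => Real.exp (-y ^ 2)) := by fun_prop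
  have := (h.differentiable_iteratedDeriv j (by exact_mod_cast j.lt_succ_self)) x
  have e : gaussDeriv (j + 1) x = deriv (gaussDeriv j) x := by
    simp only [gaussDeriv, iteratedDeriv_succ]; rfl
  rw [e]
  exact this.hasDerivAt

lemma continuous_gaussDeriv (j : ℕ) : Continuous (gaussDeriv j) :=
  continuous_iff_continuousAt.2 fun x => (hasDerivAt_gaussDeriv j x).continuousAt

lemma gaussDeriv_one (x : ℝ) : gaussDeriv 1 x = -2 * x * gaussDeriv 0 x := by
  have h := hasDerivAt_gaussDeriv 0 x
  have h2 : HasDerivAt (gaussDeriv 0) (Real.exp (-x ^ 2) * (-(2 * x))) x := by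
    have e : gaussDeriv 0 = fun y => Real.exp (-y ^ 2) := funext gaussDeriv_zero
    rw [e]
    simpa using ((hasDerivAt_pow 2 x).neg).exp
  rw [h.unique h2, gaussDeriv_zero]; ring

lemma gaussDeriv_rec (n : ℕ) (x : ℝ) :
    gaussDeriv (n + 2) x = -2 * x * gaussDeriv (n + 1) x - 2 * (n + 1) * gaussDeriv n x := by
  induction n generalizing x with
  | zero =>
    have h := hasDerivAt_gaussDeriv 1 x
    have h2 := ((hasDerivAt_id x).const_mul (-2)).mul (hasDerivAt_gaussDeriv 0 x)
    have e : gaussDeriv 1 = (fun y => -2 * id y) * gaussDeriv 0 := funext gaussDeriv_one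
    rw [← e] at h2
    rw [h.unique h2]
    simp
    ring
  | succ n ih =>
    have h := hasDerivAt_gaussDeriv (n + 2) x
    have h2 := (((hasDerivAt_id x).const_mul (-2)).mul (hasDerivAt_gaussDeriv (n + 1) x)).sub
      ((hasDerivAt_gaussDeriv n x).const_mul (2 * ((n : ℝ) + 1)))
    have e : gaussDeriv (n + 2) = (fun y => -2 * id y) * gaussDeriv (n + 1) -
        (fun y => 2 * ((n : ℝ) + 1) * gaussDeriv n y) := funext ih
    rw [← e] at h2
    rw [h.unique h2]
    simp
    ring

lemma gaussDeriv_neg (j : ℕ) (x : ℝ) : gaussDeriv j (-x) = (-1) ^ j * gaussDeriv j x := by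
  have h := iteratedDeriv_comp_neg j (fun y : ℝ => Real.exp (-y ^ 2)) x
  simp only [neg_sq, smul_eq_mul] at h
  unfold gaussDeriv
  rw [h, ← mul_assoc, ← mul_pow]
  simp

lemma gaussDeriv_eq_herm (j : ℕ) (x : ℝ) :
    gaussDeriv j x = (-1) ^ j * herm j x * Real.exp (-x ^ 2) := by
  have h1 : ((-1 : ℝ) ^ j) * (-1) ^ j = 1 := by rw [← mul_pow]; simp
  have h2 : Real.exp (x ^ 2) * Real.exp (-x ^ 2) = 1 := by rw [← Real.exp_add]; simp
  unfold gaussDeriv herm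
  linear_combination (-(iteratedDeriv j (fun y : ℝ => Real.exp (-y ^ 2)) x)) *
    (Real.exp (x ^ 2) * Real.exp (-x ^ 2) * h1 + h2)

lemma gaussDeriv_rec_two (m : ℕ) (x : ℝ) :
    gaussDeriv (m + 4) x = (4 * x ^ 2 - 4 * m - 10) * gaussDeriv (m + 2) x
      - 4 * (m + 2) * (m + 1) * gaussDeriv m x := by
  have h1 := gaussDeriv_rec (m + 2) x
  have h2 := gaussDeriv_rec (m + 1) x
  have h3 := gaussDeriv_rec m x
  push_cast at h1 h2 h3
  linear_combination h1 - 2 * x * h2 + 2 * (m + 2) * h3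

lemma lag_mul_exp_eq_gaussDeriv (m : ℕ) (x : ℝ) :
    lag m (-1 / 2) (x ^ 2) * Real.exp (-x ^ 2) =
      (-1) ^ m / ((m.factorial : ℝ) * 4 ^ m) * gaussDeriv (2 * m) x := by
  obtain ⟨h0, h1, h⟩ := isLaguerreSeries_iff.1
    (isLaguerreSeries_lag (by norm_num : (-1 : ℝ) < -1 / 2) (x ^ 2))
  induction m using Nat.twoStepInduction with
  | zero => simp [h0, gaussDeriv_zero]
  | one =>
    rw [h1, h0, gaussDeriv_rec, gaussDeriv_one, gaussDeriv_zero]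
    simp
    ring
  | more m ih1 ih2 =>
    have hm : (m : ℝ) + 2 ≠ 0 := by positivity
    have e := gaussDeriv_rec_two (2 * m) x
    rw [show 2 * (m + 2) = 2 * m + 4 by ring, e]
    apply mul_left_cancel₀ hm
    rw [← mul_assoc, h m]
    rw [show 2 * (m + 1) = 2 * m + 2 by ring] at ih2
    have e3 : (2 * m + 3 + (-1 / 2) - x ^ 2) * lag (m + 1) (-1 / 2) (x ^ 2) * Real.exp (-x ^ 2) -
        (m + 1 + (-1 / 2)) * (lag m (-1 / 2) (x ^ 2) * Real.exp (-x ^ 2)) =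
        (2 * m + 3 + (-1 / 2) - x ^ 2) * ((-1) ^ (m + 1) / (((m + 1).factorial : ℝ) * 4 ^ (m + 1)) *
          gaussDeriv (2 * m + 2) x) -
        (m + 1 + (-1 / 2)) * ((-1) ^ m / ((m.factorial : ℝ) * 4 ^ m) * gaussDeriv (2 * m) x) := by
      rw [← ih1, ← ih2]; ring
    rw [sub_mul, mul_assoc _ (lag m _ _), e3]
    simp only [Nat.factorial_succ]
    push_cast
    field_simp
    ring

lemma exists_pow_mul_exp_le (k : ℕ) :
    ∃ C, ∀ x : ℝ, |x| ^ k * Real.exp (-x ^ 2) ≤ C * Real.exp (-x ^ 2 / 2) := by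
  refine ⟨1 + k.factorial * 2 ^ k, fun x => ?_⟩
  have h1 := Real.pow_div_factorial_le_exp (x ^ 2 / 2) (by positivity) k
  have h2 : |x| ^ k ≤ 1 + (x ^ 2) ^ k := by
    rw [← sq_abs, ← pow_mul, mul_comm 2 k, pow_mul]
    nlinarith [sq_nonneg (|x| ^ k - 1), sq_nonneg (|x| ^ k)]
  have h3 : Real.exp (-x ^ 2) = Real.exp (-x ^ 2 / 2) * Real.exp (-x ^ 2 / 2) := by
    rw [← Real.exp_add]; ring_nf
  have h4 : Real.exp (x ^ 2 / 2) * Real.exp (-x ^ 2 / 2) = 1 := by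
    rw [← Real.exp_add]; ring_nf; simp
  have h6 : (1 : ℝ) ≤ Real.exp (x ^ 2 / 2) := Real.one_le_exp (by positivity)
  rw [div_pow, div_div, div_le_iff₀ (by positivity)] at h1
  have h5 : |x| ^ k ≤ (1 + k.factorial * 2 ^ k) * Real.exp (x ^ 2 / 2) := by nlinarith
  rw [h3]
  have e0 := Real.exp_pos (-x ^ 2 / 2)
  calc |x| ^ k * (Real.exp (-x ^ 2 / 2) * Real.exp (-x ^ 2 / 2))
      ≤ (1 + k.factorial * 2 ^ k) * Real.exp (x ^ 2 / 2) *
        (Real.exp (-x ^ 2 / 2) * Real.exp (-x ^ 2 / 2)) := by gcongr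
    _ = _ := by linear_combination (1 + k.factorial * 2 ^ k) * Real.exp (-x ^ 2 / 2) * h4

lemma exists_gaussDeriv_le (j : ℕ) :
    ∃ C, ∀ x : ℝ, |gaussDeriv j x| ≤ C * Real.exp (-x ^ 2 / 2) := by
  suffices h : ∀ k : ℕ, ∃ C, ∀ x : ℝ, |x| ^ k * |gaussDeriv j x| ≤ C * Real.exp (-x ^ 2 / 2) by
    simpa using h 0
  induction j using Nat.twoStepInduction with
  | zero =>
    intro k
    obtain ⟨C, hC⟩ := exists_pow_mul_exp_le k
    exact ⟨C, fun x => by simpa [gaussDeriv_zero] using hC x⟩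
  | one =>
    intro k
    obtain ⟨C, hC⟩ := exists_pow_mul_exp_le (k + 1)
    refine ⟨2 * C, fun x => ?_⟩
    have := hC x
    rw [gaussDeriv_one, gaussDeriv_zero, abs_mul, abs_mul, Real.abs_exp]
    norm_num
    rw [pow_succ] at this
    linarith
  | more n ih1 ih2 =>
    intro k
    obtain ⟨C1, h1⟩ := ih1 k
    obtain ⟨C2, h2⟩ := ih2 (k + 1)
    refine ⟨2 * C2 + 2 * (n + 1) * C1, fun x => ?_⟩
    rw [gaussDeriv_rec]
    have e1 : |-2 * x * gaussDeriv (n + 1) x - 2 * (n + 1) * gaussDeriv n x| ≤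
        2 * |x| * |gaussDeriv (n + 1) x| + 2 * (n + 1) * |gaussDeriv n x| := by
      refine (abs_sub _ _).trans (le_of_eq ?_)
      simp only [abs_mul, abs_neg, abs_two]
      rw [abs_of_nonneg (by positivity : (0 : ℝ) ≤ (n : ℝ) + 1)]
    have := mul_le_mul_of_nonneg_left e1 (by positivity : (0 : ℝ) ≤ |x| ^ k)
    have g1 := mul_le_mul_of_nonneg_left (h1 x) (by positivity : (0 : ℝ) ≤ 2 * ((n : ℝ) + 1))
    have g2 := h2 x
    rw [pow_succ] at g2
    linarith

lemma integrable_exp_neg_sq_div_two : Integrable fun x : ℝ => Real.exp (-x ^ 2 / 2) := by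
  have := integrable_exp_neg_mul_sq (by norm_num : (0 : ℝ) < 1 / 2)
  refine this.congr (Filter.Eventually.of_forall fun x => ?_)
  simp only; ring_nf

lemma tendsto_gaussDeriv (j : ℕ) :
    Filter.Tendsto (gaussDeriv j) (Filter.cocompact ℝ) (nhds 0) := by
  obtain ⟨C, hC⟩ := exists_gaussDeriv_le j
  refine squeeze_zero_norm hC ?_
  have h := tendsto_rpow_abs_mul_exp_neg_mul_sq_cocompact (by norm_num : (0 : ℝ) < 1 / 2) 0
  have h2 := h.const_mul C
  rw [mul_zero] at h2
  refine h2.congr fun x => ?_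
  rw [Real.rpow_zero, one_mul]; ring_nf

lemma integrable_gauss_mul_gaussDeriv (c x : ℝ) (p : ℕ) :
    Integrable fun y => gaussDeriv 0 (c * (x - y)) * gaussDeriv p y := by
  obtain ⟨C, hC⟩ := exists_gaussDeriv_le p
  refine (integrable_exp_neg_sq_div_two.const_mul C).mono' ?_ ?_
  · have h1 := continuous_gaussDeriv 0
    have h2 := continuous_gaussDeriv p
    exact (by fun_prop : Continuous _).aestronglyMeasurable
  · refine Filter.Eventually.of_forall fun y => ?_
    rw [norm_mul, gaussDeriv_zero, Real.norm_eq_abs, Real.abs_exp]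
    have : Real.exp (-(c * (x - y)) ^ 2) ≤ 1 := Real.exp_le_one_iff.2 (by nlinarith [sq_nonneg (c * (x - y))])
    calc _ ≤ 1 * |gaussDeriv p y| := by gcongr; exact le_of_eq rfl
      _ ≤ _ := by rw [one_mul]; exact hC y

lemma integrable_exp_neg_sq : Integrable fun x : ℝ => Real.exp (-x ^ 2) := by
  simpa using integrable_exp_neg_mul_sq (by norm_num : (0 : ℝ) < 1)

lemma erfc_eq (z : ℝ) :
    erfc z = 2 - (2 / Real.sqrt Real.pi) * ∫ s in Set.Iic z, Real.exp (-s ^ 2) := by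
  have h := intervalIntegral.integral_Iic_add_Ioi (b := z) integrable_exp_neg_sq.integrableOn
    integrable_exp_neg_sq.integrableOn
  have h2 : ∫ s : ℝ, Real.exp (-s ^ 2) = Real.sqrt Real.pi := by
    simpa using integral_gaussian 1
  rw [h2] at h
  have hp : Real.sqrt Real.pi ≠ 0 := by positivity
  rw [erfc, eq_sub_of_add_eq' h]
  field_simp

lemma hasDerivAt_erfc (z : ℝ) :
    HasDerivAt erfc (-(2 / Real.sqrt Real.pi) * gaussDeriv 0 z) z := by
  have hc : Continuous fun s : ℝ => Real.exp (-s ^ 2) := by fun_prop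
  have e : erfc = fun z => 2 - (2 / Real.sqrt Real.pi) *
      ((∫ s in Set.Iic (0 : ℝ), Real.exp (-s ^ 2)) + ∫ s in (0 : ℝ)..z, Real.exp (-s ^ 2)) := by
    funext z
    rw [erfc_eq, ← intervalIntegral.integral_Iic_sub_Iic integrable_exp_neg_sq.integrableOn
      integrable_exp_neg_sq.integrableOn]
    ring
  rw [e]
  have h := intervalIntegral.integral_hasDerivAt_right (hc.intervalIntegrable 0 z)
    (hc.stronglyMeasurableAtFilter _ _) hc.continuousAt
  have := (((h.const_add (∫ s in Set.Iic (0 : ℝ), Real.exp (-s ^ 2))).const_mul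
    (2 / Real.sqrt Real.pi)).const_sub 2)
  rw [gaussDeriv_zero]
  simpa using this

lemma tendsto_erfc_atTop : Filter.Tendsto erfc Filter.atTop (nhds 0) := by
  have h := intervalIntegral_tendsto_integral_Ioi 0 integrable_exp_neg_sq.integrableOn
    (Filter.tendsto_id (α := ℝ) (x := Filter.atTop))
  have e : erfc = fun z => (2 / Real.sqrt Real.pi) *
      ((∫ s in Set.Ioi (0 : ℝ), Real.exp (-s ^ 2)) - ∫ s in (0 : ℝ)..id z, Real.exp (-s ^ 2)) := by
    funext z
    rw [erfc, ← intervalIntegral.integral_Ioi_sub_Ioi' integrable_exp_neg_sq.integrableOn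
      integrable_exp_neg_sq.integrableOn, id, sub_sub_cancel]
  rw [e]
  have h2 := (h.const_sub (∫ s in Set.Ioi (0 : ℝ), Real.exp (-s ^ 2))).const_mul
    (2 / Real.sqrt Real.pi)
  rwa [sub_self, mul_zero] at h2

lemma erfc_neg (z : ℝ) : erfc (-z) = 2 - erfc z := by
  have h := integral_comp_neg_Ioi z fun s : ℝ => Real.exp (-s ^ 2)
  simp only [neg_sq] at h
  rw [erfc_eq, ← h, erfc]

lemma tendsto_erfc_atBot : Filter.Tendsto erfc Filter.atBot (nhds 2) := by
  have h := (tendsto_erfc_atTop.comp Filter.tendsto_neg_atBot_atTop).const_sub 2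
  rw [sub_zero] at h
  refine h.congr fun z => ?_
  rw [Function.comp_apply, erfc_neg, sub_sub_cancel]

/-- The successive derivatives of `erfc`. -/
noncomputable def erfcDeriv : ℕ → ℝ → ℝ
  | 0 => erfc
  | j + 1 => fun z => -(2 / Real.sqrt Real.pi) * gaussDeriv j z

lemma hasDerivAt_erfcDeriv (j : ℕ) (z : ℝ) :
    HasDerivAt (erfcDeriv j) (erfcDeriv (j + 1) z) z := by
  cases j with
  | zero => exact hasDerivAt_erfc z
  | succ j => exact (hasDerivAt_gaussDeriv j z).const_mul _

lemma iteratedDeriv_gauss_affine (j : ℕ) (u v : ℝ) :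
    iteratedDeriv j (fun x => gaussDeriv 0 (u + v * x)) =
      fun x => v ^ j * gaussDeriv j (u + v * x) := by
  induction j with
  | zero => simp
  | succ j ih =>
    rw [iteratedDeriv_succ, ih]
    funext x
    have h : HasDerivAt (fun x => u + v * x) v x := by
      simpa using ((hasDerivAt_id x).const_mul v).const_add u
    refine (((hasDerivAt_gaussDeriv j (u + v * x)).comp x h).const_mul (v ^ j)).deriv.trans ?_
    ring

lemma contDiff_gauss_affine (u v : ℝ) (n : WithTop ℕ∞) :
    ContDiff ℝ n (fun x => gaussDeriv 0 (u + v * x)) := by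
  have : gaussDeriv 0 = fun y => Real.exp (-y ^ 2) := funext gaussDeriv_zero
  rw [this]
  fun_prop

/-- The Leibniz formula for a factorization of a product of Gaussians. -/
lemma sum_choose_mul_gaussDeriv {s r α β : ℝ}
    (h : ∀ x y : ℝ, gaussDeriv 0 (s * (x - y)) * gaussDeriv 0 y =
      gaussDeriv 0 (α * y - β * x) * gaussDeriv 0 (r * x)) (p : ℕ) (x y : ℝ) :
    ∑ j ∈ Finset.range (p + 1), (p.choose j : ℝ) * ((-β) ^ j * gaussDeriv j (α * y - β * x)) *
      (r ^ (p - j) * gaussDeriv (p - j) (r * x)) =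
      s ^ p * gaussDeriv p (s * (x - y)) * gaussDeriv 0 y := by
  have e1 : (fun x => gaussDeriv 0 (s * (x - y)) * gaussDeriv 0 y) =
      fun x => gaussDeriv 0 (-(s * y) + s * x) * gaussDeriv 0 y := by
    funext x; ring_nf
  have e2 : (fun x => gaussDeriv 0 (α * y - β * x) * gaussDeriv 0 (r * x)) =
      fun x => gaussDeriv 0 (α * y + (-β) * x) * gaussDeriv 0 (0 + r * x) := by
    funext x; ring_nf
  have h1 : iteratedDeriv p (fun x => gaussDeriv 0 (s * (x - y)) * gaussDeriv 0 y) x =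
      s ^ p * gaussDeriv p (s * (x - y)) * gaussDeriv 0 y := by
    rw [e1, iteratedDeriv_mul_const_field, iteratedDeriv_gauss_affine]
    ring_nf
  rw [← h1, show (fun x => gaussDeriv 0 (s * (x - y)) * gaussDeriv 0 y) = _ from
    funext fun x => h x y, e2, iteratedDeriv_fun_mul (contDiff_gauss_affine _ _ _).contDiffAt
      (contDiff_gauss_affine _ _ _).contDiffAt]
  refine Finset.sum_congr rfl fun j _ => ?_
  rw [iteratedDeriv_gauss_affine, iteratedDeriv_gauss_affine]
  ring_nf

/-- A primitive in `y` of `y ↦ (s / √π) * exp (-(s * (x - y)) ^ 2) * gaussDeriv p y`. -/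
noncomputable def heatPrimitive (s r α β : ℝ) (p : ℕ) (x y : ℝ) : ℝ :=
  -(r / 2) * ∑ j ∈ Finset.range (p + 1), (p.choose j : ℝ) * ((-β) ^ j *
      erfcDeriv j (α * y - β * x)) * (r ^ (p - j) * gaussDeriv (p - j) (r * x)) +
    s / Real.sqrt Real.pi * ∑ j ∈ Finset.range p,
      s ^ j * gaussDeriv j (s * (x - y)) * gaussDeriv (p - 1 - j) y

lemma hasDerivAt_heatPrimitive {s r α β : ℝ} (hr : α * r = s)
    (h : ∀ x y : ℝ, gaussDeriv 0 (s * (x - y)) * gaussDeriv 0 y =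
      gaussDeriv 0 (α * y - β * x) * gaussDeriv 0 (r * x)) (p : ℕ) (x y : ℝ) :
    HasDerivAt (heatPrimitive s r α β p x)
      (s / Real.sqrt Real.pi * (gaussDeriv 0 (s * (x - y)) * gaussDeriv p y)) y := by
  have a1 : HasDerivAt (fun y => α * y - β * x) α y := by
    simpa using ((hasDerivAt_id y).const_mul α).sub_const (β * x)
  have a2 : HasDerivAt (fun y => s * (x - y)) (-s) y := by
    simpa using ((hasDerivAt_id y).const_sub x).const_mul s
  have d1 : HasDerivAt (fun y => ∑ j ∈ Finset.range (p + 1), (p.choose j : ℝ) * ((-β) ^ j *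
      erfcDeriv j (α * y - β * x)) * (r ^ (p - j) * gaussDeriv (p - j) (r * x)))
      (∑ j ∈ Finset.range (p + 1), (p.choose j : ℝ) * ((-β) ^ j *
      (erfcDeriv (j + 1) (α * y - β * x) * α)) * (r ^ (p - j) * gaussDeriv (p - j) (r * x))) y :=
    HasDerivAt.fun_sum fun j _ =>
      ((((hasDerivAt_erfcDeriv j _).comp y a1).const_mul _).const_mul _).mul_const _
  have d2 : HasDerivAt (fun y => ∑ j ∈ Finset.range p,
      s ^ j * gaussDeriv j (s * (x - y)) * gaussDeriv (p - 1 - j) y)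
      (∑ j ∈ Finset.range p, (s ^ j * (gaussDeriv (j + 1) (s * (x - y)) * (-s)) *
        gaussDeriv (p - 1 - j) y +
        s ^ j * gaussDeriv j (s * (x - y)) * gaussDeriv (p - 1 - j + 1) y)) y :=
    HasDerivAt.fun_sum fun j _ =>
      (((hasDerivAt_gaussDeriv j _).comp y a2).const_mul _).mul (hasDerivAt_gaussDeriv _ y)
  have d := (d1.const_mul (-(r / 2))).add (d2.const_mul (s / Real.sqrt Real.pi))
  refine d.congr_deriv ?_
  have t1 : ∑ j ∈ Finset.range (p + 1), (p.choose j : ℝ) * ((-β) ^ j *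
      (erfcDeriv (j + 1) (α * y - β * x) * α)) * (r ^ (p - j) * gaussDeriv (p - j) (r * x)) =
      -(2 / Real.sqrt Real.pi) * α * (s ^ p * gaussDeriv p (s * (x - y)) * gaussDeriv 0 y) := by
    rw [← sum_choose_mul_gaussDeriv h, Finset.mul_sum]
    refine Finset.sum_congr rfl fun j _ => ?_
    simp only [erfcDeriv]
    ring
  have t2 : ∑ j ∈ Finset.range p, (s ^ j * (gaussDeriv (j + 1) (s * (x - y)) * (-s)) *
        gaussDeriv (p - 1 - j) y +
        s ^ j * gaussDeriv j (s * (x - y)) * gaussDeriv (p - 1 - j + 1) y) =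
      gaussDeriv 0 (s * (x - y)) * gaussDeriv p y -
        s ^ p * gaussDeriv p (s * (x - y)) * gaussDeriv 0 y := by
    have := Finset.sum_range_sub'
      (fun j => s ^ j * gaussDeriv j (s * (x - y)) * gaussDeriv (p - j) y) p
    simp only [pow_zero, one_mul, Nat.sub_zero, Nat.sub_self] at this
    rw [← this]
    refine Finset.sum_congr rfl fun j hj => ?_
    have hj' := Finset.mem_range.1 hj
    rw [show p - 1 - j + 1 = p - j by lia, show p - (j + 1) = p - 1 - j by lia]
    ring
  rw [t1, t2, ← hr]
  ring

lemma tendsto_heatPrimitive {s r α β : ℝ} {p : ℕ} {x L : ℝ} {l : Filter ℝ}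
    (h1 : Filter.Tendsto (fun y => s * (x - y)) l (Filter.cocompact ℝ))
    (h2 : Filter.Tendsto (fun y => α * y - β * x) l (Filter.cocompact ℝ))
    (h3 : l ≤ Filter.cocompact ℝ)
    (h4 : Filter.Tendsto (fun y => erfc (α * y - β * x)) l (nhds L)) :
    Filter.Tendsto (heatPrimitive s r α β p x) l
      (nhds (-(r / 2) * (L * (r ^ p * gaussDeriv p (r * x))))) := by
  have e : -(r / 2) * (L * (r ^ p * gaussDeriv p (r * x))) =
      -(r / 2) * ∑ j ∈ Finset.range (p + 1), (p.choose j : ℝ) * ((-β) ^ j *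
      (if j = 0 then L else 0)) * (r ^ (p - j) * gaussDeriv (p - j) (r * x)) +
    s / Real.sqrt Real.pi * ∑ j ∈ Finset.range p, s ^ j * 0 * 0 := by
    rw [Finset.sum_range_succ']
    simp
  rw [e]
  refine ((tendsto_finsetSum _ fun j _ => ((Filter.Tendsto.const_mul _ ?_).const_mul
    _).mul_const _).const_mul _).add ((tendsto_finsetSum _ fun j _ => (((tendsto_gaussDeriv
      j).comp h1).const_mul _).mul ((tendsto_gaussDeriv _).mono_left h3)).const_mul _)
  rcases j with _ | j
  · simpa [erfcDeriv] using h4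
  · have := ((tendsto_gaussDeriv j).comp h2).const_mul (-(2 / Real.sqrt Real.pi))
    simpa [erfcDeriv] using this

lemma integral_Ioi_heat_gaussDeriv {s r α β : ℝ} (hs : 0 < s) (hα : 0 < α) (hr : α * r = s)
    (h : ∀ x y : ℝ, gaussDeriv 0 (s * (x - y)) * gaussDeriv 0 y =
      gaussDeriv 0 (α * y - β * x) * gaussDeriv 0 (r * x)) (p : ℕ) (x a : ℝ) :
    ∫ y in Set.Ioi a, s / Real.sqrt Real.pi * (gaussDeriv 0 (s * (x - y)) * gaussDeriv p y) =
      - heatPrimitive s r α β p x a := by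
  have t2 : Filter.Tendsto (fun y => α * y - β * x) Filter.atTop Filter.atTop :=
    Filter.tendsto_atTop_add_const_right _ _ (Filter.tendsto_id.const_mul_atTop hα)
  have t1 : Filter.Tendsto (fun y => s * (x - y)) Filter.atTop Filter.atBot :=
    (Filter.tendsto_atBot_add_const_left _ x Filter.tendsto_neg_atTop_atBot).const_mul_atBot hs
  rw [integral_Ioi_of_hasDerivAt_of_tendsto' (fun y _ => hasDerivAt_heatPrimitive hr h p x y)
    ((integrable_gauss_mul_gaussDeriv s x p).const_mul _).integrableOn
    (tendsto_heatPrimitive (t1.mono_right atBot_le_cocompact) (t2.mono_right atTop_le_cocompact)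
      atTop_le_cocompact (tendsto_erfc_atTop.comp t2))]
  simp

lemma integral_heat_gaussDeriv {s r α β : ℝ} (hs : 0 < s) (hα : 0 < α) (hr : α * r = s)
    (h : ∀ x y : ℝ, gaussDeriv 0 (s * (x - y)) * gaussDeriv 0 y =
      gaussDeriv 0 (α * y - β * x) * gaussDeriv 0 (r * x)) (p : ℕ) (x : ℝ) :
    ∫ y, s / Real.sqrt Real.pi * (gaussDeriv 0 (s * (x - y)) * gaussDeriv p y) =
      r ^ (p + 1) * gaussDeriv p (r * x) := by
  have t2 : Filter.Tendsto (fun y => α * y - β * x) Filter.atTop Filter.atTop :=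
    Filter.tendsto_atTop_add_const_right _ _ (Filter.tendsto_id.const_mul_atTop hα)
  have t1 : Filter.Tendsto (fun y => s * (x - y)) Filter.atTop Filter.atBot :=
    (Filter.tendsto_atBot_add_const_left _ x Filter.tendsto_neg_atTop_atBot).const_mul_atBot hs
  have b2 : Filter.Tendsto (fun y => α * y - β * x) Filter.atBot Filter.atBot :=
    Filter.tendsto_atBot_add_const_right _ _ (Filter.tendsto_id.const_mul_atBot hα)
  have b1 : Filter.Tendsto (fun y => s * (x - y)) Filter.atBot Filter.atTop :=
    (Filter.tendsto_atTop_add_const_left _ x Filter.tendsto_neg_atBot_atTop).const_mul_atTop hs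
  rw [integral_of_hasDerivAt_of_tendsto (fun y => hasDerivAt_heatPrimitive hr h p x y)
    ((integrable_gauss_mul_gaussDeriv s x p).const_mul _)
    (tendsto_heatPrimitive (b1.mono_right atTop_le_cocompact) (b2.mono_right atBot_le_cocompact)
      atBot_le_cocompact (tendsto_erfc_atBot.comp b2))
    (tendsto_heatPrimitive (t1.mono_right atBot_le_cocompact) (t2.mono_right atTop_le_cocompact)
      atTop_le_cocompact (tendsto_erfc_atTop.comp t2))]
  ring

/-- `L_m^{(-1/2)}(y²) e^{-y²}`, a multiple of the even Gaussian derivative of order `2m`. -/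
noncomputable def gaussLag (m : ℕ) (y : ℝ) : ℝ :=
  (-1) ^ m / ((m.factorial : ℝ) * 4 ^ m) * gaussDeriv (2 * m) y

lemma lag_mul_exp_eq_sum {n : ℕ} (hn : 1 ≤ n) (y : Fin n → ℝ) (k : ℕ) :
    lag k ((n : ℝ) / 2 - 1) (∑ i, y i ^ 2) * Real.exp (-∑ i, y i ^ 2) =
      ∑ α ∈ Finset.univ.finsuppAntidiag k, ∏ i, gaussLag (α i) (y i) := by
  rw [lag_sum hn, ← Finset.sum_neg_distrib, Real.exp_sum, Finset.sum_mul]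
  refine Finset.sum_congr rfl fun α _ => ?_
  rw [← Finset.prod_mul_distrib]
  exact Finset.prod_congr rfl fun i _ => lag_mul_exp_eq_gaussDeriv _ _

lemma lag_mul_exp_eq_sum_sum {n : ℕ} (hn : 1 ≤ n) {M : ℕ} (hM : 1 ≤ M) (y : Fin n → ℝ) :
    lag (M - 1) ((n : ℝ) / 2) (∑ i, y i ^ 2) * Real.exp (-∑ i, y i ^ 2) =
      ∑ k ∈ Finset.range M, ∑ α ∈ Finset.univ.finsuppAntidiag k,
        ∏ i, gaussLag (α i) (y i) := by
  have hn' : (1 : ℝ) ≤ n := by exact_mod_cast hn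
  have h := lag_add_one (by linarith : (-1 : ℝ) < (n : ℝ) / 2 - 1) (∑ i, y i ^ 2) (M - 1)
  rw [sub_add_cancel, Nat.sub_add_cancel hM] at h
  rw [h, Finset.sum_mul]
  exact Finset.sum_congr rfl fun k _ => lag_mul_exp_eq_sum hn y k

lemma sum_finsuppAntidiag_castSucc {d : ℕ} (k : ℕ) (u : Fin d → ℕ → ℝ) (v : ℕ → ℝ) :
    ∑ α ∈ (Finset.univ : Finset (Fin (d + 1))).finsuppAntidiag k,
        (∏ i : Fin d, u i (α i.castSucc)) * v (α (Fin.last d)) =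
      ∑ l ∈ Finset.range (k + 1),
        (∑ α ∈ Finset.univ.finsuppAntidiag l, ∏ i : Fin d, u i (α i)) * v (k - l) := by
  let G : Fin (d + 1) → PowerSeries ℝ := Fin.snoc (fun i => PowerSeries.mk (u i)) (PowerSeries.mk v)
  have h : PowerSeries.coeff k (∏ i, G i) =
      PowerSeries.coeff k ((∏ i : Fin d, PowerSeries.mk (u i)) * PowerSeries.mk v) := by
    rw [Fin.prod_univ_castSucc]; simp [G]
  rw [PowerSeries.coeff_prod, PowerSeries.coeff_mul,
    Finset.Nat.sum_antidiagonal_eq_sum_range_succ_mk] at h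
  simp only [Fin.prod_univ_castSucc] at h
  simpa [G, PowerSeries.coeff_prod] using h

lemma heat_gauss_identity {t : ℝ} (ht : 0 < t) (x y : ℝ) :
    gaussDeriv 0 ((Real.sqrt t)⁻¹ * (x - y)) * gaussDeriv 0 y =
      gaussDeriv 0 (Real.sqrt ((1 + t) / t) * y -
        (Real.sqrt t)⁻¹ * (Real.sqrt (1 + t))⁻¹ * x) *
      gaussDeriv 0 ((Real.sqrt (1 + t))⁻¹ * x) := by
  have h1 : Real.sqrt t ^ 2 = t := Real.sq_sqrt ht.le
  have h2 : Real.sqrt (1 + t) ^ 2 = 1 + t := Real.sq_sqrt (by linarith)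
  have p1 : 0 < Real.sqrt t := Real.sqrt_pos.2 ht
  have p2 : 0 < Real.sqrt (1 + t) := Real.sqrt_pos.2 (by linarith)
  simp only [gaussDeriv_zero, ← Real.exp_add]
  rw [Real.sqrt_div (by linarith)]
  congr 1
  set S := Real.sqrt t
  set R := Real.sqrt (1 + t)
  have h3 : R ^ 2 = 1 + S ^ 2 := by rw [h1, h2]
  field_simp
  linear_combination (y ^ 2 * R ^ 2 - x ^ 2) * h3

lemma Fn_eq {t : ℝ} (ht : 0 < t) (x a : ℝ) :
    Fn t x a = Real.sqrt ((1 + t) / t) * a - (Real.sqrt t)⁻¹ * (Real.sqrt (1 + t))⁻¹ * x := by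
  have h2 : Real.sqrt (1 + t) ^ 2 = 1 + t := Real.sq_sqrt (by linarith)
  have p1 : 0 < Real.sqrt t := Real.sqrt_pos.2 ht
  have p2 : 0 < Real.sqrt (1 + t) := Real.sqrt_pos.2 (by linarith)
  rw [Fn, Real.sqrt_div (by linarith), ← h2, Real.sqrt_sq p2.le]
  field_simp

lemma integral_heat_gaussLag {t : ℝ} (ht : 0 < t) (m : ℕ) (x : ℝ) :
    ∫ y, (Real.sqrt t)⁻¹ / Real.sqrt Real.pi * gaussDeriv 0 ((Real.sqrt t)⁻¹ * (x - y)) *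
        gaussLag m y =
      (Real.sqrt (1 + t))⁻¹ ^ (2 * m + 1) * gaussLag m ((Real.sqrt (1 + t))⁻¹ * x) := by
  have p1 : 0 < Real.sqrt t := Real.sqrt_pos.2 ht
  have p2 : 0 < Real.sqrt (1 + t) := Real.sqrt_pos.2 (by linarith)
  have h := integral_heat_gaussDeriv (s := (Real.sqrt t)⁻¹) (r := (Real.sqrt (1 + t))⁻¹)
    (by positivity) (by positivity) (by rw [Real.sqrt_div (by linarith)]; field_simp)
    (heat_gauss_identity ht) (2 * m) x
  unfold gaussLag
  rw [mul_left_comm, ← h, ← integral_const_mul]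
  congr 1
  funext y
  ring

/-- The integral over a half line of the heat kernel against `gaussLag m`. -/
noncomputable def halfHeat (t x a : ℝ) (m : ℕ) : ℝ :=
  ∫ y in Set.Ici a, (Real.sqrt t)⁻¹ / Real.sqrt Real.pi *
    gaussDeriv 0 ((Real.sqrt t)⁻¹ * (x - y)) * gaussLag m y

lemma halfHeat_eq {t : ℝ} (ht : 0 < t) (x a : ℝ) (m : ℕ) :
    halfHeat t x a m =
      1 / 2 * erfc (Fn t x a) * (Real.sqrt (1 + t))⁻¹ ^ (2 * m + 1) *
          gaussLag m ((Real.sqrt (1 + t))⁻¹ * x) +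
        (-1) ^ m / ((m.factorial : ℝ) * 4 ^ m) / Real.sqrt Real.pi *
          Real.exp (-(Fn t x a) ^ 2) * Real.exp (-((Real.sqrt (1 + t))⁻¹ * x) ^ 2) *
        ∑ j ∈ Finset.range (2 * m), (-1) ^ (j + 1) * (Real.sqrt t)⁻¹ ^ (j + 1) *
          (((2 * m).choose (j + 1) : ℝ) * herm (2 * m - (j + 1)) ((Real.sqrt (1 + t))⁻¹ * x) *
            herm j (Fn t x a) * (Real.sqrt (1 + t))⁻¹ ^ (2 * m + 1) -
            herm j ((Real.sqrt t)⁻¹ * (a - x)) * herm (2 * m - (j + 1)) a) := by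
  have p1 : 0 < Real.sqrt t := Real.sqrt_pos.2 ht
  have p2 : 0 < Real.sqrt (1 + t) := Real.sqrt_pos.2 (by linarith)
  have hid := heat_gauss_identity ht x a
  have h := integral_Ioi_heat_gaussDeriv (s := (Real.sqrt t)⁻¹) (r := (Real.sqrt (1 + t))⁻¹)
    (by positivity) (by positivity) (by rw [Real.sqrt_div (by linarith)]; field_simp)
    (heat_gauss_identity ht) (2 * m) x a
  have e : halfHeat t x a m = (-1) ^ m / ((m.factorial : ℝ) * 4 ^ m) *
      ∫ y in Set.Ioi a, (Real.sqrt t)⁻¹ / Real.sqrt Real.pi *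
        (gaussDeriv 0 ((Real.sqrt t)⁻¹ * (x - y)) * gaussDeriv (2 * m) y) := by
    rw [halfHeat, integral_Ici_eq_integral_Ioi, ← integral_const_mul]
    congr 1
    funext y
    unfold gaussLag
    ring
  rw [e, h, heatPrimitive, Finset.sum_range_succ']
  rw [← Fn_eq ht] at *
  set s := (Real.sqrt t)⁻¹
  set r := (Real.sqrt (1 + t))⁻¹
  set F := Fn t x a
  set w : ℝ := (-1) ^ m / ((m.factorial : ℝ) * 4 ^ m)
  simp only [gaussDeriv_zero] at hid
  have f1 : ∑ j ∈ Finset.range (2 * m), ((2 * m).choose (j + 1) : ℝ) * ((-(s * r)) ^ (j + 1) *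
      erfcDeriv (j + 1) F) * (r ^ (2 * m - (j + 1)) * gaussDeriv (2 * m - (j + 1)) (r * x)) =
      -(2 / Real.sqrt Real.pi) * Real.exp (-F ^ 2) * Real.exp (-(r * x) ^ 2) * r ^ (2 * m) *
      ∑ j ∈ Finset.range (2 * m), (-1) ^ (j + 1) * s ^ (j + 1) *
          (-((2 * m).choose (j + 1) : ℝ) * herm (2 * m - (j + 1)) (r * x) * herm j F) := by
    rw [Finset.mul_sum]
    refine Finset.sum_congr rfl fun j hj => ?_
    have hj' : j + 1 ≤ 2 * m := Finset.mem_range.1 hj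
    simp only [erfcDeriv, gaussDeriv_eq_herm]
    have e1 : r ^ (2 * m) = r ^ (j + 1) * r ^ (2 * m - (j + 1)) := by
      rw [← pow_add]; congr 1; omega
    have e2 : (-1 : ℝ) ^ j * (-1) ^ (2 * m - (j + 1)) = -1 := by
      rw [← pow_add]; exact Odd.neg_one_pow ⟨m - 1, by omega⟩
    rw [e1, neg_pow (s * r), mul_pow]
    linear_combination (-1) ^ (j + 1) * (2 / Real.sqrt Real.pi) * Real.exp (-F ^ 2) *
      Real.exp (-(r * x) ^ 2) * s ^ (j + 1) * r ^ (j + 1) * r ^ (2 * m - (j + 1)) *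
      ((2 * m).choose (j + 1) : ℝ) * herm (2 * m - (j + 1)) (r * x) * herm j F * (-e2)
  have f2 : ∑ j ∈ Finset.range (2 * m),
      s ^ j * gaussDeriv j (s * (x - a)) * gaussDeriv (2 * m - 1 - j) a =
      Real.exp (-F ^ 2) * Real.exp (-(r * x) ^ 2) *
      ∑ j ∈ Finset.range (2 * m), (-1) ^ (j + 1) * s ^ j *
        (herm j (s * (a - x)) * herm (2 * m - (j + 1)) a) := by
    rw [Finset.mul_sum]
    refine Finset.sum_congr rfl fun j hj => ?_
    have hj' : j + 1 ≤ 2 * m := Finset.mem_range.1 hj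
    have e0 : s * (x - a) = -(s * (a - x)) := by ring
    have e1 : 2 * m - 1 - j = 2 * m - (j + 1) := by omega
    have e2 : (-1 : ℝ) ^ j * (-1) ^ (2 * m - (j + 1)) = -1 := by
      rw [← pow_add]; exact Odd.neg_one_pow ⟨m - 1, by omega⟩
    rw [e0, neg_sq] at hid
    rw [e0, e1, gaussDeriv_neg, gaussDeriv_eq_herm, gaussDeriv_eq_herm]
    linear_combination (-1) ^ j * s ^ j * herm j (s * (a - x)) * herm (2 * m - (j + 1)) a *
      (Real.exp (-(s * (a - x)) ^ 2) * Real.exp (-a ^ 2) * e2 - hid)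
  have f3 : ∑ j ∈ Finset.range (2 * m), (-1) ^ (j + 1) * s ^ (j + 1) *
      (((2 * m).choose (j + 1) : ℝ) * herm (2 * m - (j + 1)) (r * x) * herm j F * r ^ (2 * m + 1) -
        herm j (s * (a - x)) * herm (2 * m - (j + 1)) a) =
      - r ^ (2 * m + 1) * (∑ j ∈ Finset.range (2 * m), (-1) ^ (j + 1) * s ^ (j + 1) *
          (-((2 * m).choose (j + 1) : ℝ) * herm (2 * m - (j + 1)) (r * x) * herm j F)) -
        s * ∑ j ∈ Finset.range (2 * m), (-1) ^ (j + 1) * s ^ j *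
          (herm j (s * (a - x)) * herm (2 * m - (j + 1)) a) := by
    rw [Finset.mul_sum, Finset.mul_sum, ← Finset.sum_sub_distrib]
    exact Finset.sum_congr rfl fun j _ => by ring
  rw [f1, f2, f3]
  simp only [erfcDeriv, gaussLag, Nat.choose_zero_right, pow_zero, Nat.cast_one, Nat.sub_zero,
    one_mul]
  ring

lemma integrable_heat_gaussLag (t x : ℝ) (m : ℕ) :
    Integrable fun y => (Real.sqrt t)⁻¹ / Real.sqrt Real.pi *
      gaussDeriv 0 ((Real.sqrt t)⁻¹ * (x - y)) * gaussLag m y := by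
  refine ((integrable_gauss_mul_gaussDeriv (Real.sqrt t)⁻¹ x (2 * m)).const_mul
    ((Real.sqrt t)⁻¹ / Real.sqrt Real.pi * ((-1) ^ m / ((m.factorial : ℝ) * 4 ^ m)))).congr ?_
  filter_upwards with y
  unfold gaussLag
  ring

lemma setIntegral_prod_heat_gaussLag {d : ℕ} {t : ℝ} (ht : 0 < t) (x : Fin (d + 1) → ℝ) (a : ℝ)
    (α : Fin (d + 1) → ℕ) :
    IntegrableOn (fun y : Fin (d + 1) → ℝ => ∏ i, ((Real.sqrt t)⁻¹ / Real.sqrt Real.pi *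
        gaussDeriv 0 ((Real.sqrt t)⁻¹ * (x i - y i)) * gaussLag (α i) (y i)))
        {y | a ≤ y (Fin.last d)} ∧
      ∫ y in {y : Fin (d + 1) → ℝ | a ≤ y (Fin.last d)},
        ∏ i, ((Real.sqrt t)⁻¹ / Real.sqrt Real.pi *
          gaussDeriv 0 ((Real.sqrt t)⁻¹ * (x i - y i)) * gaussLag (α i) (y i)) =
      (∏ i : Fin d, (Real.sqrt (1 + t))⁻¹ ^ (2 * α i.castSucc + 1) *
          gaussLag (α i.castSucc) ((Real.sqrt (1 + t))⁻¹ * x i.castSucc)) *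
        halfHeat t (x (Fin.last d)) a (α (Fin.last d)) := by
  let T : Fin (d + 1) → Set ℝ := Fin.snoc (fun _ => Set.univ) (Set.Ici a)
  have hT : {y : Fin (d + 1) → ℝ | a ≤ y (Fin.last d)} = Set.univ.pi T := by
    ext y
    simp [T, Set.mem_pi, Fin.forall_fin_succ']
  have hint := fun i => integrable_heat_gaussLag t (x i) (α i)
  rw [hT, IntegrableOn, volume_pi, Measure.restrict_pi_pi]
  refine ⟨Integrable.fintype_prod (f := fun i y => (Real.sqrt t)⁻¹ / Real.sqrt Real.pi *
    gaussDeriv 0 ((Real.sqrt t)⁻¹ * (x i - y)) * gaussLag (α i) y)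
    fun i => (hint i).mono_measure Measure.restrict_le_self, ?_⟩
  rw [integral_fintype_prod_eq_prod (fun i y => (Real.sqrt t)⁻¹ / Real.sqrt Real.pi *
    gaussDeriv 0 ((Real.sqrt t)⁻¹ * (x i - y)) * gaussLag (α i) y), Fin.prod_univ_castSucc]
  simp only [Fin.snoc_castSucc, Fin.snoc_last, Measure.restrict_univ, halfHeat]
  congr 1
  exact Finset.prod_congr rfl fun i _ => integral_heat_gaussLag ht _ _

lemma sum_prod_pow_gaussLag {d : ℕ} (hd : 1 ≤ d) (r : ℝ) (x : Fin d → ℝ) (l : ℕ) :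
    ∑ α ∈ Finset.univ.finsuppAntidiag l, ∏ i : Fin d,
        (r ^ (2 * α i + 1) * gaussLag (α i) (r * x i)) =
      r ^ (2 * l + d) * lag l ((d : ℝ) / 2 - 1) (r ^ 2 * ∑ i, x i ^ 2) *
        Real.exp (-(r ^ 2 * ∑ i, x i ^ 2)) := by
  have h := lag_mul_exp_eq_sum hd (fun i => r * x i) l
  simp only [mul_pow, ← Finset.mul_sum] at h
  rw [mul_assoc, h, Finset.mul_sum]
  refine Finset.sum_congr rfl fun α hα => ?_
  rw [Finset.mem_finsuppAntidiag] at hα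
  rw [Finset.prod_mul_distrib, Finset.prod_pow_eq_pow_sum, Finset.sum_add_distrib,
    ← Finset.mul_sum, hα.1]
  simp

lemma setIntegral_heat_lag {d : ℕ} (hd : 1 ≤ d) {M : ℕ} (hM : 1 ≤ M) {t : ℝ} (ht : 0 < t)
    (x : Fin (d + 1) → ℝ) (a : ℝ) :
    ∫ y in {y : Fin (d + 1) → ℝ | a ≤ y (Fin.last d)},
        (∏ i, ((Real.sqrt t)⁻¹ / Real.sqrt Real.pi *
          gaussDeriv 0 ((Real.sqrt t)⁻¹ * (x i - y i)))) *
        (lag (M - 1) (((d + 1 : ℕ) : ℝ) / 2) (∑ i, y i ^ 2) * Real.exp (-∑ i, y i ^ 2)) =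
      ∑ k ∈ Finset.range M, ∑ l ∈ Finset.range (k + 1),
        ((Real.sqrt (1 + t))⁻¹ ^ (2 * l + d) *
          lag l ((d : ℝ) / 2 - 1) ((Real.sqrt (1 + t))⁻¹ ^ 2 * ∑ i : Fin d, x i.castSucc ^ 2) *
          Real.exp (-((Real.sqrt (1 + t))⁻¹ ^ 2 * ∑ i : Fin d, x i.castSucc ^ 2))) *
        halfHeat t (x (Fin.last d)) a (k - l) := by
  have h := fun (α : Fin (d + 1) →₀ ℕ) => setIntegral_prod_heat_gaussLag ht x a α
  simp only [lag_mul_exp_eq_sum_sum (Nat.le_add_left 1 d) hM, Finset.mul_sum,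
    ← Finset.prod_mul_distrib]
  rw [integral_finsetSum _ fun k _ => integrable_finsetSum _ fun α _ => (h α).1]
  refine Finset.sum_congr rfl fun k _ => ?_
  rw [integral_finsetSum _ fun α _ => (h α).1, Finset.sum_congr rfl fun α _ => (h α).2]
  have e := sum_finsuppAntidiag_castSucc k
    (fun (i : Fin d) m => (Real.sqrt (1 + t))⁻¹ ^ (2 * m + 1) *
      gaussLag m ((Real.sqrt (1 + t))⁻¹ * x i.castSucc)) (halfHeat t (x (Fin.last d)) a)
  rw [e]
  refine Finset.sum_congr rfl fun l _ => ?_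
  rw [sum_prod_pow_gaussLag hd]
  simp only [Finset.mul_sum]

lemma inv_sqrt_pow {u : ℝ} (hu : 0 < u) (n : ℕ) :
    (Real.sqrt u)⁻¹ ^ n = u ^ (-(n : ℝ) / 2) := by
  rw [Real.sqrt_eq_rpow, ← Real.rpow_neg hu.le, ← Real.rpow_mul_natCast hu.le]
  congr 1
  ring

lemma sum_halfHeat_summand {d k l : ℕ} (hl : l ≤ k) {t : ℝ} (ht : 0 < t) (ρ xn a : ℝ) :
    ((Real.sqrt (1 + t))⁻¹ ^ (2 * l + d) *
          lag l ((d : ℝ) / 2 - 1) ((Real.sqrt (1 + t))⁻¹ ^ 2 * ρ) *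
          Real.exp (-((Real.sqrt (1 + t))⁻¹ ^ 2 * ρ))) * halfHeat t xn a (k - l) =
      1 / 2 * Real.exp (-(ρ + xn ^ 2) / (1 + t)) *
        (erfc (Fn t xn a) * ((1 + t) ^ (-(k : ℝ) - ((d + 1 : ℕ) : ℝ) / 2) *
          (lag l ((d : ℝ) / 2 - 1) (ρ / (1 + t)) * lag (k - l) (-1 / 2) (xn ^ 2 / (1 + t)))) +
        Real.pi ^ (-(1 : ℝ) / 2) * Real.exp (-(Fn t xn a) ^ 2) *
          (2 * (1 + t) ^ (-(((d + 1 : ℕ) : ℝ) - 1) / 2) *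
            (((-1 : ℝ) ^ (k - l) / (((k - l).factorial : ℝ) * (4 : ℝ) ^ (k - l))) *
        lag l ((((d + 1 : ℕ) : ℝ) - 3) / 2) (ρ / (1 + t)) *
        ∑ j ∈ Finset.Icc 1 (2 * (k - l)),
          ((-1 : ℝ) ^ j / t ^ ((j : ℝ) / 2)) *
            (((2 * (k - l)).choose j : ℝ) * herm (2 * (k - l) - j) (xn / Real.sqrt (1 + t)) *
                herm (j - 1) (Fn t xn a) / (1 + t) ^ ((k : ℝ) + 1 / 2)
              - herm (j - 1) ((a - xn) / Real.sqrt t) * herm (2 * (k - l) - j) a /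
                  (1 + t) ^ (l : ℝ))))) := by
  have hu : 0 < 1 + t := by linarith
  obtain ⟨m, rfl⟩ := Nat.exists_eq_add_of_le hl
  have p1 : 0 < Real.sqrt t := Real.sqrt_pos.2 ht
  have p2 : 0 < Real.sqrt (1 + t) := Real.sqrt_pos.2 hu
  have hr : (Real.sqrt (1 + t))⁻¹ ^ 2 = (1 + t)⁻¹ := by
    rw [inv_pow, Real.sq_sqrt hu.le]
  have a1 : (1 + t) ^ (-((l + m : ℕ) : ℝ) - ((d + 1 : ℕ) : ℝ) / 2) =
      (Real.sqrt (1 + t))⁻¹ ^ (2 * (l + m) + d + 1) := by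
    rw [inv_sqrt_pow hu]; congr 1; push_cast; ring
  have a2 : (1 + t) ^ (-(((d + 1 : ℕ) : ℝ) - 1) / 2) = (Real.sqrt (1 + t))⁻¹ ^ d := by
    rw [inv_sqrt_pow hu]; congr 1; push_cast; ring
  have a3 : Real.pi ^ (-(1 : ℝ) / 2) = (Real.sqrt Real.pi)⁻¹ := by
    rw [← pow_one (Real.sqrt Real.pi)⁻¹, inv_sqrt_pow Real.pi_pos, Nat.cast_one]
  have a4 : (((d + 1 : ℕ) : ℝ) - 3) / 2 = (d : ℝ) / 2 - 1 := by push_cast; ring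
  have a5 : ((1 + t) ^ (((l + m : ℕ) : ℝ) + 1 / 2))⁻¹ =
      (Real.sqrt (1 + t))⁻¹ ^ (2 * (l + m) + 1) := by
    rw [inv_sqrt_pow hu, ← Real.rpow_neg hu.le]; congr 1; push_cast; ring
  have a6 : ((1 + t) ^ (l : ℝ))⁻¹ = (Real.sqrt (1 + t))⁻¹ ^ (2 * l) := by
    rw [inv_sqrt_pow hu, ← Real.rpow_neg hu.le]; congr 1; push_cast; ring
  have a7 : ∀ j : ℕ, (t ^ ((j : ℝ) / 2))⁻¹ = (Real.sqrt t)⁻¹ ^ j := fun j => by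
    rw [inv_sqrt_pow ht, ← Real.rpow_neg ht.le, neg_div]
  have a8 : gaussLag m ((Real.sqrt (1 + t))⁻¹ * xn) =
      lag m (-1 / 2) (xn ^ 2 / (1 + t)) * Real.exp (-((Real.sqrt (1 + t))⁻¹ * xn) ^ 2) := by
    rw [gaussLag, ← lag_mul_exp_eq_gaussDeriv, mul_pow, hr, inv_mul_eq_div]
  have a9 : Real.exp (-(ρ + xn ^ 2) / (1 + t)) = Real.exp (-((Real.sqrt (1 + t))⁻¹ ^ 2 * ρ)) *
      Real.exp (-((Real.sqrt (1 + t))⁻¹ * xn) ^ 2) := by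
    rw [← Real.exp_add, mul_pow, hr]; congr 1; field_simp; ring
  have a10 : ∑ j ∈ Finset.Icc 1 (2 * m),
          ((-1 : ℝ) ^ j / t ^ ((j : ℝ) / 2)) *
            (((2 * m).choose j : ℝ) * herm (2 * m - j) (xn / Real.sqrt (1 + t)) *
                herm (j - 1) (Fn t xn a) / (1 + t) ^ (((l + m : ℕ) : ℝ) + 1 / 2)
              - herm (j - 1) ((a - xn) / Real.sqrt t) * herm (2 * m - j) a /
                  (1 + t) ^ (l : ℝ)) = (Real.sqrt (1 + t))⁻¹ ^ (2 * l) *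
        ∑ j ∈ Finset.range (2 * m), (-1) ^ (j + 1) * (Real.sqrt t)⁻¹ ^ (j + 1) *
          (((2 * m).choose (j + 1) : ℝ) * herm (2 * m - (j + 1)) ((Real.sqrt (1 + t))⁻¹ * xn) *
            herm j (Fn t xn a) * (Real.sqrt (1 + t))⁻¹ ^ (2 * m + 1) -
            herm j ((Real.sqrt t)⁻¹ * (a - xn)) * herm (2 * m - (j + 1)) a) := by
    rw [← Finset.Ico_add_one_right_eq_Icc, Finset.sum_Ico_eq_sum_range, Finset.mul_sum,
      Nat.add_sub_cancel]
    refine Finset.sum_congr rfl fun j _ => ?_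
    rw [add_comm 1 j, Nat.add_sub_cancel, div_eq_mul_inv _ (t ^ _), a7,
      div_eq_mul_inv _ ((1 + t) ^ (_ + _)), a5, div_eq_mul_inv _ ((1 + t) ^ (l : ℝ)), a6,
      div_eq_inv_mul xn, div_eq_inv_mul (a - xn)]
    ring
  rw [Nat.add_sub_cancel_left, halfHeat_eq ht, a10, a1, a2, a3, a4, a8, a9, hr, inv_mul_eq_div]
  ring

lemma sum_halfHeat {d : ℕ} (hd : 1 ≤ d) (M : ℕ) {t : ℝ} (ht : 0 < t) (ρ xn a : ℝ) :
    ∑ k ∈ Finset.range M, ∑ l ∈ Finset.range (k + 1),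
        ((Real.sqrt (1 + t))⁻¹ ^ (2 * l + d) *
          lag l ((d : ℝ) / 2 - 1) ((Real.sqrt (1 + t))⁻¹ ^ 2 * ρ) *
          Real.exp (-((Real.sqrt (1 + t))⁻¹ ^ 2 * ρ))) * halfHeat t xn a (k - l) =
      1 / 2 * (Real.exp (-(ρ + xn ^ 2) / (1 + t)) *
        (erfc (Fn t xn a) * calP (d + 1) M (ρ + xn ^ 2) t +
          Real.pi ^ (-(1 : ℝ) / 2) * Real.exp (-(Fn t xn a) ^ 2) *
            calQ (d + 1) M ρ xn t a)) := by
  have hd' : (1 : ℝ) ≤ d := by exact_mod_cast hd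
  have h : calP (d + 1) M (ρ + xn ^ 2) t = ∑ k ∈ Finset.range M, ∑ l ∈ Finset.range (k + 1),
      (1 + t) ^ (-(k : ℝ) - ((d + 1 : ℕ) : ℝ) / 2) *
          (lag l ((d : ℝ) / 2 - 1) (ρ / (1 + t)) * lag (k - l) (-1 / 2) (xn ^ 2 / (1 + t))) := by
    refine Finset.sum_congr rfl fun k _ => ?_
    rw [← Finset.mul_sum, ← lag_add (by linarith) (by norm_num), add_div]
    congr 2
    push_cast
    ring
  rw [h, calQ, ← mul_assoc]
  simp only [Finset.mul_sum (Finset.range _), ← Finset.sum_add_distrib]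
  exact Finset.sum_congr rfl fun k _ => Finset.sum_congr rfl fun l hl =>
    sum_halfHeat_summand (Nat.lt_succ_iff.1 (Finset.mem_range.1 hl)) ht _ _ _

/-- The heat kernel `(π t)^{-n/2} e^{-|z|²/t}` on `ℝⁿ`. -/
noncomputable def heatKernel {n : ℕ} (t : ℝ) (z : EuclideanSpace ℝ (Fin n)) : ℝ :=
  ((Real.sqrt t)⁻¹ / Real.sqrt Real.pi) ^ n * Real.exp (-(t⁻¹ * ‖z‖ ^ 2))

lemma setIntegral_heat_eta {d : ℕ} (hd : 1 ≤ d) {M : ℕ} (hM : 1 ≤ M) {t : ℝ} (ht : 0 < t)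
    (x : EuclideanSpace ℝ (Fin (d + 1))) (a : ℝ) :
    ∫ y in {y : EuclideanSpace ℝ (Fin (d + 1)) | a ≤ y (Fin.last d)},
        heatKernel t (x - y) * (lag (M - 1) (((d + 1 : ℕ) : ℝ) / 2) (‖y‖ ^ 2) * Real.exp (-‖y‖ ^ 2)) =
      1 / 2 * (Real.exp (-‖x‖ ^ 2 / (1 + t)) *
        (erfc (Fn t (x (Fin.last d)) a) * calP (d + 1) M (‖x‖ ^ 2) t +
          Real.pi ^ (-(1 : ℝ) / 2) * Real.exp (-(Fn t (x (Fin.last d)) a) ^ 2) *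
            calQ (d + 1) M (∑ i : Fin d, x i.castSucc ^ 2) (x (Fin.last d)) t a)) := by
  have hx : ‖x‖ ^ 2 = ∑ i : Fin d, x i.castSucc ^ 2 + x (Fin.last d) ^ 2 := by
    rw [EuclideanSpace.real_norm_sq_eq, Fin.sum_univ_castSucc]
  rw [hx, ← sum_halfHeat hd M ht, ← setIntegral_heat_lag hd hM ht (fun i => x i) a,
    ← (PiLp.volume_preserving_toLp (Fin (d + 1))).setIntegral_preimage_emb
      (MeasurableEquiv.toLp 2 (Fin (d + 1) → ℝ)).measurableEmbedding]
  congr 1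
  funext y
  simp only [heatKernel, EuclideanSpace.real_norm_sq_eq, PiLp.sub_apply, gaussDeriv_zero,
    Finset.prod_mul_distrib, Finset.prod_const, Finset.card_univ, Fintype.card_fin,
    ← Real.exp_sum, mul_pow, inv_pow, Real.sq_sqrt ht.le, Finset.mul_sum, Finset.sum_neg_distrib]

lemma heatKernel_nonneg {n : ℕ} (t : ℝ) (z : EuclideanSpace ℝ (Fin n)) : 0 ≤ heatKernel t z := by
  unfold heatKernel
  positivity

lemma inv_sqrt_div_sqrt_pi_pow (n : ℕ) {t : ℝ} (ht : 0 < t) :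
    ((Real.sqrt t)⁻¹ / Real.sqrt Real.pi) ^ n =
      Real.pi ^ (-(n : ℝ) / 2) * t ^ (-(n : ℝ) / 2) := by
  rw [div_eq_mul_inv, mul_pow, inv_sqrt_pow ht, inv_sqrt_pow Real.pi_pos, mul_comm]

lemma heatKernel_le {n : ℕ} {t : ℝ} (ht : 0 < t) (z : EuclideanSpace ℝ (Fin n)) :
    heatKernel t z ≤ Real.pi ^ (-(n : ℝ) / 2) * t ^ (-(n : ℝ) / 2) := by
  rw [heatKernel, inv_sqrt_div_sqrt_pi_pow n ht]
  refine mul_le_of_le_one_right (by positivity) (Real.exp_le_one_iff.2 ?_)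
  have : 0 ≤ t⁻¹ * ‖z‖ ^ 2 := by positivity
  linarith

lemma integral_heatKernel_sub {n : ℕ} {t : ℝ} (ht : 0 < t) (x : EuclideanSpace ℝ (Fin n)) :
    ∫ y, heatKernel t (x - y) = 1 := by
  rw [integral_sub_left_eq_self (fun y => heatKernel t y)]
  have h := GaussianFourier.integral_rexp_neg_mul_sq_norm (V := EuclideanSpace ℝ (Fin n))
    (inv_pos.2 ht)
  simp only [neg_mul, finrank_euclideanSpace, Fintype.card_fin] at h
  simp only [heatKernel]
  rw [integral_const_mul, h, inv_sqrt_div_sqrt_pi_pow n ht, div_inv_eq_mul,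
    Real.mul_rpow Real.pi_pos.le ht.le, neg_div, Real.rpow_neg Real.pi_pos.le, Real.rpow_neg ht.le]
  have := Real.rpow_pos_of_pos Real.pi_pos ((n : ℝ) / 2)
  have := Real.rpow_pos_of_pos ht ((n : ℝ) / 2)
  field_simp

lemma integrable_heatKernel_sub {n : ℕ} {t : ℝ} (ht : 0 < t) (x : EuclideanSpace ℝ (Fin n)) :
    Integrable fun y => heatKernel t (x - y) :=
  integrable_of_integral_eq_one (integral_heatKernel_sub ht x)

lemma integral_Ioi_heatKernel {n : ℕ} (hn : 3 ≤ n) {z : EuclideanSpace ℝ (Fin n)} (hz : z ≠ 0) :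
    ∫ t in Set.Ioi (0 : ℝ), heatKernel t z =
      Real.Gamma ((n : ℝ) / 2 - 1) / Real.pi ^ ((n : ℝ) / 2) * ‖z‖ ^ ((2 : ℝ) - n) := by
  have hn' : (3 : ℝ) ≤ n := by exact_mod_cast hn
  have hz' : 0 < ‖z‖ := norm_pos_iff.2 hz
  rw [← integral_comp_rpow_Ioi _ (by norm_num : (-1 : ℝ) ≠ 0)]
  have e : Set.EqOn (fun u : ℝ => (|(-1 : ℝ)| * u ^ ((-1 : ℝ) - 1)) • heatKernel (u ^ (-1 : ℝ)) z)
      (fun u => Real.pi ^ (-(n : ℝ) / 2) *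
        (u ^ (((n : ℝ) / 2 - 1) - 1) * Real.exp (-(‖z‖ ^ 2 * u)))) (Set.Ioi 0) := by
    intro u hu
    have hu : 0 < u := hu
    simp only [heatKernel, smul_eq_mul]
    rw [inv_sqrt_div_sqrt_pi_pow n (Real.rpow_pos_of_pos hu _), ← Real.rpow_mul hu.le,
      Real.rpow_neg_one, inv_inv, abs_neg, abs_one, one_mul, mul_comm u (‖z‖ ^ 2)]
    rw [show ((n : ℝ) / 2 - 1) - 1 = ((-1 : ℝ) - 1) + -1 * (-(n : ℝ) / 2) by ring,
      Real.rpow_add hu]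
    ring
  rw [setIntegral_congr_fun measurableSet_Ioi e, integral_const_mul,
    Real.integral_rpow_mul_exp_neg_mul_Ioi (by linarith) (by positivity), one_div, ← inv_pow,
    ← Real.rpow_natCast_mul (by positivity), Real.inv_rpow hz'.le, ← Real.rpow_neg hz'.le,
    neg_div, Real.rpow_neg Real.pi_pos.le]
  rw [show -(((2 : ℕ) : ℝ) * ((n : ℝ) / 2 - 1)) = (2 : ℝ) - n by push_cast; ring]
  ring

lemma exists_lag_mul_exp_le (k : ℕ) (γ : ℝ) :
    ∃ C, ∀ w : ℝ, |lag k γ (w ^ 2) * Real.exp (-w ^ 2)| ≤ C * Real.exp (-w ^ 2 / 2) := by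
  choose C hC using exists_pow_mul_exp_le
  refine ⟨∑ i ∈ Finset.range (k + 1), |(-1 : ℝ) ^ i * (Real.Gamma ((k : ℝ) + γ + 1) /
      (Real.Gamma ((i : ℝ) + γ + 1) * ((k - i).factorial : ℝ))) / (i.factorial : ℝ)| *
      C (2 * i), fun w => ?_⟩
  rw [lag, Finset.sum_mul, Finset.sum_mul]
  refine (Finset.abs_sum_le_sum_abs _ _).trans (Finset.sum_le_sum fun i _ => ?_)
  have h := mul_le_mul_of_nonneg_left (hC (2 * i) w) (abs_nonneg ((-1 : ℝ) ^ i *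
    (Real.Gamma ((k : ℝ) + γ + 1) / (Real.Gamma ((i : ℝ) + γ + 1) * ((k - i).factorial : ℝ))) /
    (i.factorial : ℝ)))
  rw [← mul_assoc, ← mul_assoc] at h
  refine le_of_eq_of_le ?_ h
  rw [← abs_pow, ← abs_of_pos (Real.exp_pos (-w ^ 2)), ← abs_mul, ← abs_mul, abs_of_pos
    (Real.exp_pos _)]
  ring_nf

lemma continuous_lag (k : ℕ) (γ : ℝ) : Continuous (lag k γ) := by
  unfold lag
  fun_prop

lemma integrable_heatKernel_mul {n : ℕ} (hn : 3 ≤ n) (x : EuclideanSpace ℝ (Fin n))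
    {G : EuclideanSpace ℝ (Fin n) → ℝ} (hG : Measurable G) (hGi : Integrable G) {C : ℝ}
    (hC : ∀ y, |G y| ≤ C) :
    Integrable (fun p : ℝ × EuclideanSpace ℝ (Fin n) => heatKernel p.1 (x - p.2) * G p.2)
      ((volume.restrict (Set.Ioi 0)).prod volume) := by
  have hn' : (3 : ℝ) ≤ n := by exact_mod_cast hn
  have hm : Measurable fun p : ℝ × EuclideanSpace ℝ (Fin n) =>
      heatKernel p.1 (x - p.2) * G p.2 := by
    unfold heatKernel
    fun_prop
  have hint : ∀ t : ℝ, 0 < t → Integrable fun y => heatKernel t (x - y) * G y := fun t ht =>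
    (integrable_heatKernel_sub ht x).mul_bdd hG.aestronglyMeasurable (Filter.Eventually.of_forall hC)
  have hnorm : ∀ t y, ‖heatKernel t (x - y) * G y‖ = heatKernel t (x - y) * |G y| := fun t y => by
    rw [norm_mul, Real.norm_of_nonneg (heatKernel_nonneg _ _), Real.norm_eq_abs]
  rw [integrable_prod_iff hm.aestronglyMeasurable]
  refine ⟨(ae_restrict_iff' measurableSet_Ioi).2 (Filter.Eventually.of_forall hint), ?_⟩
  have hsm := (hm.aestronglyMeasurable (μ := (volume.restrict (Set.Ioi 0)).prod
    volume)).norm.integral_prod_right'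
  rw [← Set.Ioc_union_Ioi_eq_Ioi zero_le_one] at hsm ⊢
  refine IntegrableOn.union (Integrable.mono' (g := fun _ => C) ?_ (hsm.mono_measure
    (Measure.restrict_mono Set.subset_union_left le_rfl)) ?_) (Integrable.mono'
    (g := fun t => (Real.pi ^ (-(n : ℝ) / 2) * ∫ y, |G y|) * t ^ (-(n : ℝ) / 2)) ?_
    (hsm.mono_measure (Measure.restrict_mono Set.subset_union_right le_rfl)) ?_)
  · exact integrable_const _
  · refine (ae_restrict_iff' measurableSet_Ioc).2 (Filter.Eventually.of_forall fun t ht => ?_)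
    rw [Real.norm_of_nonneg (integral_nonneg fun _ => norm_nonneg _)]
    calc ∫ y, ‖heatKernel t (x - y) * G y‖ ≤ ∫ y, heatKernel t (x - y) * C := by
          refine integral_mono (hint t ht.1).norm
            ((integrable_heatKernel_sub ht.1 x).mul_const C) fun y => ?_
          rw [hnorm]
          exact mul_le_mul_of_nonneg_left (hC y) (heatKernel_nonneg _ _)
      _ = C := by rw [integral_mul_const, integral_heatKernel_sub ht.1, one_mul]
  · exact (integrableOn_Ioi_rpow_of_lt (by linarith) one_pos).const_mul _
  · refine (ae_restrict_iff' measurableSet_Ioi).2 (Filter.Eventually.of_forall fun t ht => ?_)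
    have ht0 : 0 < t := zero_lt_one.trans ht
    rw [Real.norm_of_nonneg (integral_nonneg fun _ => norm_nonneg _), mul_right_comm,
      ← integral_const_mul]
    refine integral_mono (hint t ht0).norm (hGi.abs.const_mul _) fun y => ?_
    rw [hnorm]
    exact mul_le_mul_of_nonneg_right (heatKernel_le ht0 _) (abs_nonneg _)

lemma integrable_heatKernel_mul_lag {n : ℕ} (hn : 3 ≤ n) (x : EuclideanSpace ℝ (Fin n)) (k : ℕ)
    (γ : ℝ) :
    Integrable (fun p : ℝ × EuclideanSpace ℝ (Fin n) => heatKernel p.1 (x - p.2) *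
      (lag k γ (‖p.2‖ ^ 2) * Real.exp (-‖p.2‖ ^ 2)))
      ((volume.restrict (Set.Ioi 0)).prod volume) := by
  obtain ⟨C, hC⟩ := exists_lag_mul_exp_le k γ
  have hC0 : 0 ≤ C := by simpa using (abs_nonneg _).trans (hC 0)
  have hc : Continuous fun y : EuclideanSpace ℝ (Fin n) =>
      lag k γ (‖y‖ ^ 2) * Real.exp (-‖y‖ ^ 2) :=
    ((continuous_lag k γ).comp (by fun_prop)).mul (by fun_prop)
  refine integrable_heatKernel_mul hn x (G := fun y => lag k γ (‖y‖ ^ 2) * Real.exp (-‖y‖ ^ 2))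
    hc.measurable ?_ (C := C) fun y => (hC ‖y‖).trans ?_
  · refine Integrable.mono' (g := fun y => C * Real.exp (-(1 / 2) * ‖y‖ ^ 2)) ?_
      hc.aestronglyMeasurable (Filter.Eventually.of_forall fun y => ?_)
    · refine (Integrable.of_integral_ne_zero ?_).const_mul C
      rw [GaussianFourier.integral_rexp_neg_mul_sq_norm (by norm_num)]
      have := Real.pi_pos
      positivity
    · refine (hC ‖y‖).trans_eq ?_
      congr 2
      ring
  · exact mul_le_of_le_one_right hC0 (Real.exp_le_one_iff.2 (by nlinarith [sq_nonneg ‖y‖]))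

/-- half-space Newtonian potential of `η_{2M}` in dimension `n = d+1 ≥ 3`. -/
theorem stmt1 (d : ℕ) (hd : 2 ≤ d) (M : ℕ) (hM : 1 ≤ M) (a : ℝ)
    (x : EuclideanSpace ℝ (Fin (d + 1))) :
    (∫ y in {y : EuclideanSpace ℝ (Fin (d + 1)) | a ≤ y (Fin.last d)},
        (Real.Gamma (((d : ℝ) + 1) / 2 - 1) / (4 * Real.pi ^ (((d : ℝ) + 1) / 2))) *
          ‖x - y‖ ^ ((2 : ℝ) - ((d : ℝ) + 1)) * eta (d + 1) M y)
    = (1 / (8 * Real.pi ^ (((d : ℝ) + 1) / 2))) *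
        ∫ t in Set.Ioi (0 : ℝ),
          Real.exp (-‖x‖ ^ 2 / (1 + t)) *
            (erfc (Fn t (x (Fin.last d)) a) * calP (d + 1) M (‖x‖ ^ 2) t
              + Real.pi ^ (-(1 : ℝ) / 2) * Real.exp (-(Fn t (x (Fin.last d)) a) ^ 2) *
                  calQ (d + 1) M (∑ i : Fin d, (x i.castSucc) ^ 2) (x (Fin.last d)) t a) := by
  have hn : 3 ≤ d + 1 := by omega
  have hcast : ((d + 1 : ℕ) : ℝ) = (d : ℝ) + 1 := by push_cast; ring
  set H := {y : EuclideanSpace ℝ (Fin (d + 1)) | a ≤ y (Fin.last d)}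
  have hint := (integrable_heatKernel_mul_lag hn x (M - 1)
    (((d + 1 : ℕ) : ℝ) / 2)).mono_measure
    (Measure.prod_mono le_rfl (Measure.restrict_le_self (s := H)))
  have hne : ∀ᵐ y ∂volume.restrict H, y ≠ x :=
    ae_restrict_of_ae (Measure.ae_ne volume x)
  calc ∫ y in H, (Real.Gamma (((d : ℝ) + 1) / 2 - 1) / (4 * Real.pi ^ (((d : ℝ) + 1) / 2))) *
          ‖x - y‖ ^ ((2 : ℝ) - ((d : ℝ) + 1)) * eta (d + 1) M y
      = ∫ y in H, Real.pi ^ (-((d + 1 : ℕ) : ℝ) / 2) / 4 *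
          ∫ t in Set.Ioi (0 : ℝ), heatKernel t (x - y) *
            (lag (M - 1) (((d + 1 : ℕ) : ℝ) / 2) (‖y‖ ^ 2) * Real.exp (-‖y‖ ^ 2)) := by
        refine integral_congr_ae ?_
        filter_upwards [hne] with y hy
        rw [integral_mul_const, integral_Ioi_heatKernel hn (sub_ne_zero.2 hy.symm), eta, hcast]
        ring
    _ = Real.pi ^ (-((d + 1 : ℕ) : ℝ) / 2) / 4 * ∫ t in Set.Ioi (0 : ℝ), ∫ y in H,
          heatKernel t (x - y) *
            (lag (M - 1) (((d + 1 : ℕ) : ℝ) / 2) (‖y‖ ^ 2) * Real.exp (-‖y‖ ^ 2)) := by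
        rw [integral_const_mul, ← integral_integral_swap hint]
    _ = _ := by
        have h := setIntegral_congr_fun (μ := volume) (f := fun t => ∫ y in H,
          heatKernel t (x - y) * (lag (M - 1) (((d + 1 : ℕ) : ℝ) / 2) (‖y‖ ^ 2) *
            Real.exp (-‖y‖ ^ 2))) measurableSet_Ioi
          fun t ht => setIntegral_heat_eta (by omega) hM ht x a
        rw [h, integral_const_mul, hcast, neg_div, Real.rpow_neg Real.pi_pos.le]
        ring
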